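/- Let a : ℕ → ℤ be a finitely supported sequence with a 0 = 1. Then there exists a finitely supported sequence a' : ℕ → ℤ with a' 0 = 1 such that ∑ᵢ a i · (−4)^i = ∑ᵢ a' i · (−4)^i and 3·(a' 1) − (a' 1)² + 2·(a' 2) ≡ 3·(a 1) − (a 1)² + 2·(a 2) + 2 (mod 4). (This is the arithmetic content of the paper's claim that for every determinant value d there exist knots K, K′ with determinant d such that v₄ₐ(K) ≡ 0 and v₄ₐ(K′) ≡ 1 modulo 2, using the standard realization theorem that any even integer polynomial with constant term 1 occurs as the Conway polynomial of some knot.) -/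

import Mathlib

/-- For any finitely supported coefficient sequence `a : ℕ →₀ ℤ` with `a 0 = 1`
(the coefficients of a Conway polynomial), there is a finitely supported
sequence `a'` with `a' 0 = 1`, the same determinant `∑ᵢ a i (−4)^i`, and with
`3·a'₁ − a'₁² + 2·a'₂ ≡ 3·a₁ − a₁² + 2·a₂ + 2 (mod 4)`, i.e. the opposite
parity of `v₄ₐ`. -/
theorem stmt_3 (a : ℕ →₀ ℤ) (h0 : a 0 = 1) :
    ∃ a' : ℕ →₀ ℤ, a' 0 = 1 ∧
      (a.sum fun i c => c * (-4 : ℤ) ^ i) = (a'.sum fun i c => c * (-4 : ℤ) ^ i) ∧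
      3 * a' 1 - (a' 1) ^ 2 + 2 * a' 2
        ≡ 3 * a 1 - (a 1) ^ 2 + 2 * a 2 + 2 [ZMOD 4] := by
  refine ⟨a + (Finsupp.single 1 4 + Finsupp.single 2 1), ?_, ?_, ?_⟩
  · simp [h0]
  · have hz : ∀ i : ℕ, (0 : ℤ) * (-4 : ℤ) ^ i = 0 := fun i => zero_mul _
    have hadd : ∀ (i : ℕ) (x y : ℤ),
        (x + y) * (-4 : ℤ) ^ i = x * (-4 : ℤ) ^ i + y * (-4 : ℤ) ^ i :=
      fun i x y => add_mul _ _ _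
    rw [Finsupp.sum_add_index' hz hadd, Finsupp.sum_add_index' hz hadd,
      Finsupp.sum_single_index (hz 1), Finsupp.sum_single_index (hz 2)]
    norm_num
  · have h1 : (a + (Finsupp.single 1 4 + Finsupp.single 2 1) : ℕ →₀ ℤ) 1 = a 1 + 4 := by
      simp
    have h2 : (a + (Finsupp.single 1 4 + Finsupp.single 2 1) : ℕ →₀ ℤ) 2 = a 2 + 1 := by
      simp
    rw [h1, h2]
    apply Int.ModEq.symm
    rw [Int.modEq_iff_dvd]
    exact ⟨-2 * a 1 - 1, by ring⟩
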